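/- In the BIBPA setting, for every k ≥ 1 and every i ∈ {1,…,N}: Φ(x^{k,i}) ≤ Φ(x^{k,i−1}) + ( |α_i^k|/(σ_i γ_i^k) − (1 − γ_i^k L_i)/γ_i^k )·D_{h_i}(x^{k,i}, x^{k,i−1}) + ( |α_i^k|/(σ_i γ_i^k) )·D_{h_i}(x^{k−1,i}, x^{k−1,i−1}). -/

import Mathlib

open scoped RealInnerProductSpace
open Filter

/-- The `i`-th partial (block) gradient of `h` at `x`. -/
noncomputable def blockGrad {N : ℕ} {n : Fin N → ℕ}
    (h : ((j : Fin N) → EuclideanSpace ℝ (Fin (n j))) → ℝ)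
    (i : Fin N) (x : (j : Fin N) → EuclideanSpace ℝ (Fin (n j))) :
    EuclideanSpace ℝ (Fin (n i)) :=
  gradient (fun z => h (Function.update x i z)) (x i)

/-- The `i`-th block Bregman distance `D_h(x⟨i←w⟩, x)`. -/
noncomputable def blockBreg {N : ℕ} {n : Fin N → ℕ}
    (h : ((j : Fin N) → EuclideanSpace ℝ (Fin (n j))) → ℝ)
    (i : Fin N) (x : (j : Fin N) → EuclideanSpace ℝ (Fin (n j)))
    (w : EuclideanSpace ℝ (Fin (n i))) : ℝ :=
  h (Function.update x i w) - h x - ⟪blockGrad h i x, w - x i⟫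

/-- The `i`-th block Bregman distance `D_h(y, y')` between two points differing
only in their `i`-th block. -/
noncomputable def bregTwo {N : ℕ} {n : Fin N → ℕ}
    (h : ((j : Fin N) → EuclideanSpace ℝ (Fin (n j))) → ℝ)
    (i : Fin N) (y y' : (j : Fin N) → EuclideanSpace ℝ (Fin (n j))) : ℝ :=
  h y - h y' - ⟪blockGrad h i y', y i - y' i⟫

/-- The intermediate BIBPA point `x^{k,m}` whose first `m` blocks come from `x^{k+1}`
and whose remaining blocks come from `x^k`. -/
def interPt {N : ℕ} {n : Fin N → ℕ}
    (x : ℕ → (j : Fin N) → EuclideanSpace ℝ (Fin (n j))) (k m : ℕ) :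
    (j : Fin N) → EuclideanSpace ℝ (Fin (n j)) :=
  fun j => if (j : ℕ) < m then x (k + 1) j else x k j

/-- The BIBPA objective `Φ(x) = f(x) + Σᵢ gᵢ(xᵢ)` with extended-real valued `gᵢ`. -/
noncomputable def Phi {N : ℕ} {n : Fin N → ℕ}
    (f : ((j : Fin N) → EuclideanSpace ℝ (Fin (n j))) → ℝ)
    (g : (i : Fin N) → EuclideanSpace ℝ (Fin (n i)) → EReal)
    (y : (j : Fin N) → EuclideanSpace ℝ (Fin (n j))) : EReal :=
  ((f y : ℝ) : EReal) + ∑ i, g i (y i)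

section FirstOrder

variable {E : Type*} [NormedAddCommGroup E]

/-- First-order characterization of convexity: a convex function lies above its tangents. -/
lemma ConvexOn.apply_sub_le_sub_of_hasFDerivAt [NormedSpace ℝ E] {φ : E → ℝ}
    (hφ : ConvexOn ℝ Set.univ φ) {φ' : E →L[ℝ] ℝ} {a : E} (h : HasFDerivAt φ φ' a) (w : E) :
    φ' (w - a) ≤ φ w - φ a := by
  have hline : ConvexOn ℝ Set.univ (φ ∘ AffineMap.lineMap (k := ℝ) a w) := by
    simpa using hφ.comp_affineMap (AffineMap.lineMap (k := ℝ) a w)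
  have hderiv : HasDerivAt (φ ∘ AffineMap.lineMap (k := ℝ) a w) (φ' (w - a)) 0 :=
    HasFDerivAt.comp_hasDerivAt (0 : ℝ) (by simpa using h) AffineMap.hasDerivAt_lineMap
  simpa [slope_def_field] using
    hline.le_slope_of_hasDerivAt (Set.mem_univ 0) (Set.mem_univ 1) zero_lt_one hderiv

variable [InnerProductSpace ℝ E] [CompleteSpace E]

lemma inner_gradient_le_of_convexOn_smul_sub {H F : E → ℝ} {L : ℝ} {a : E}
    (hconv : ConvexOn ℝ Set.univ (fun z => L * H z - F z))
    (hH : DifferentiableAt ℝ H a) (hF : DifferentiableAt ℝ F a) (w : E) :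
    F w - F a - ⟪gradient F a, w - a⟫ ≤ L * (H w - H a - ⟪gradient H a, w - a⟫) := by
  have key := hconv.apply_sub_le_sub_of_hasFDerivAt
    ((hH.hasGradientAt.hasFDerivAt.const_mul L).sub hF.hasGradientAt.hasFDerivAt) w
  simp only [sub_apply, smul_apply, smul_eq_mul,
    InnerProductSpace.toDual_apply_apply] at key
  linarith

lemma sq_norm_le_of_convexOn_sub_sq_norm {H : E → ℝ} {σ : ℝ} {a : E}
    (hconv : ConvexOn ℝ Set.univ (fun z => H z - σ / 2 * ‖z‖ ^ 2))
    (hH : DifferentiableAt ℝ H a) (w : E) :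
    σ / 2 * ‖w - a‖ ^ 2 ≤ H w - H a - ⟪gradient H a, w - a⟫ := by
  have key := hconv.apply_sub_le_sub_of_hasFDerivAt
    (hH.hasGradientAt.hasFDerivAt.sub
      ((hasStrictFDerivAt_norm_sq a).hasFDerivAt.const_mul (σ / 2))) w
  simp only [sub_apply, smul_apply, smul_eq_mul,
    InnerProductSpace.toDual_apply_apply, innerSL_apply_apply, nsmul_eq_mul,
    Nat.cast_ofNat] at key
  have hexp := norm_sub_sq_real w a
  rw [inner_sub_right a w a, real_inner_self_eq_norm_sq, real_inner_comm w a] at key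
  rw [hexp]
  linarith

end FirstOrder

lemma inner_smul_le_abs_mul_sq_norm_add_sq_norm {E : Type*} [NormedAddCommGroup E]
    [InnerProductSpace ℝ E] (c : ℝ) (u v : E) :
    ⟪c • u, v⟫ ≤ |c| * (‖u‖ ^ 2 / 2 + ‖v‖ ^ 2 / 2) := by
  rw [real_inner_smul_left]
  calc c * ⟪u, v⟫ ≤ |c| * |⟪u, v⟫| := (le_abs_self _).trans (abs_mul _ _).le
    _ ≤ |c| * (‖u‖ ^ 2 / 2 + ‖v‖ ^ 2 / 2) := by
      gcongr
      nlinarith [abs_real_inner_le_norm u v, sq_nonneg (‖u‖ - ‖v‖)]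

section Block

variable {N : ℕ} {n : Fin N → ℕ}

lemma interPt_succ (x : ℕ → (j : Fin N) → EuclideanSpace ℝ (Fin (n j))) (k : ℕ) (i : Fin N) :
    interPt x k (i + 1) = Function.update (interPt x k i) i (x (k + 1) i) := by
  funext j
  rcases eq_or_ne j i with rfl | hj
  · simp [interPt]
  · have hne : (j : ℕ) ≠ i := Fin.val_ne_of_ne hj
    have hiff : (j : ℕ) < i + 1 ↔ (j : ℕ) < i := by omega
    simp [interPt, hj, hiff]

lemma interPt_self (x : ℕ → (j : Fin N) → EuclideanSpace ℝ (Fin (n j))) (k : ℕ) (i : Fin N) :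
    interPt x k i i = x k i := by
  simp [interPt]

lemma bregTwo_update (h : ((j : Fin N) → EuclideanSpace ℝ (Fin (n j))) → ℝ) (i : Fin N)
    (y : (j : Fin N) → EuclideanSpace ℝ (Fin (n j))) (w : EuclideanSpace ℝ (Fin (n i))) :
    bregTwo h i (Function.update y i w) y = blockBreg h i y w := by
  simp [bregTwo, blockBreg]

lemma Differentiable.comp_update {h : ((j : Fin N) → EuclideanSpace ℝ (Fin (n j))) → ℝ}
    (hh : Differentiable ℝ h) (y : (j : Fin N) → EuclideanSpace ℝ (Fin (n j))) (i : Fin N) :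
    Differentiable ℝ (fun z => h (Function.update y i z)) :=
  fun z => (hh _).comp z (hasFDerivAt_update y z).differentiableAt

lemma blockBreg_le_mul_blockBreg
    {f h : ((j : Fin N) → EuclideanSpace ℝ (Fin (n j))) → ℝ} {L : ℝ} {i : Fin N}
    {y : (j : Fin N) → EuclideanSpace ℝ (Fin (n j))}
    (hconv : ConvexOn ℝ Set.univ (fun z : EuclideanSpace ℝ (Fin (n i)) =>
      L * h (Function.update y i z) - f (Function.update y i z)))
    (hh : Differentiable ℝ h) (hf : Differentiable ℝ f) (w : EuclideanSpace ℝ (Fin (n i))) :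
    blockBreg f i y w ≤ L * blockBreg h i y w := by
  simpa [blockBreg, blockGrad] using inner_gradient_le_of_convexOn_smul_sub hconv
    (hh.comp_update y i (y i)) (hf.comp_update y i (y i)) w

lemma sq_norm_le_blockBreg
    {h : ((j : Fin N) → EuclideanSpace ℝ (Fin (n j))) → ℝ} {σ : ℝ} {i : Fin N}
    {y : (j : Fin N) → EuclideanSpace ℝ (Fin (n j))}
    (hconv : ConvexOn ℝ Set.univ (fun z : EuclideanSpace ℝ (Fin (n i)) =>
      h (Function.update y i z) - σ / 2 * ‖z‖ ^ 2))
    (hh : Differentiable ℝ h) (w : EuclideanSpace ℝ (Fin (n i))) :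
    σ / 2 * ‖w - y i‖ ^ 2 ≤ blockBreg h i y w := by
  simpa [blockBreg, blockGrad] using
    sq_norm_le_of_convexOn_sub_sq_norm hconv (hh.comp_update y i (y i)) w

lemma blockBreg_self (h : ((j : Fin N) → EuclideanSpace ℝ (Fin (n j))) → ℝ) (i : Fin N)
    (y : (j : Fin N) → EuclideanSpace ℝ (Fin (n j))) : blockBreg h i y (y i) = 0 := by
  simp [blockBreg]

lemma Phi_eq_coe (f : ((j : Fin N) → EuclideanSpace ℝ (Fin (n j))) → ℝ)
    {g : (i : Fin N) → EuclideanSpace ℝ (Fin (n i)) → EReal}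
    {y : (j : Fin N) → EuclideanSpace ℝ (Fin (n j))}
    (htop : ∀ i, g i (y i) ≠ ⊤) (hbot : ∀ i, g i (y i) ≠ ⊥) :
    Phi f g y = ((f y + ∑ i, (g i (y i)).toReal : ℝ) : EReal) := by
  have hsum : ∑ i, g i (y i) = ((∑ i, (g i (y i)).toReal : ℝ) : EReal) := by
    refine .trans ?_ (map_sum (⟨⟨Real.toEReal, rfl⟩, EReal.coe_add⟩ : ℝ →+ EReal) _ _).symm
    exact Finset.sum_congr rfl fun i _ => (EReal.coe_toReal (htop i) (hbot i)).symm
  rw [Phi, hsum, EReal.coe_add]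

end Block

lemma Finset.sum_apply_update_add {ι M : Type*} [Fintype ι] [DecidableEq ι] [AddCommMonoid M]
    {X : ι → Type*} (G : (i : ι) → X i → M) (y : (i : ι) → X i) (i : ι) (w : X i) :
    ∑ j, G j (Function.update y i w j) + G i (y i) = ∑ j, G j (y j) + G i w := by
  rw [← Finset.add_sum_erase _ _ (Finset.mem_univ i),
    ← Finset.add_sum_erase _ (fun j => G j (y j)) (Finset.mem_univ i),
    Finset.sum_congr rfl fun j hj => by
      rw [Function.update_of_ne (Finset.ne_of_mem_erase hj)]]
  simp only [Function.update_self]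
  ac_rfl

/-- BIBPA cyclic inequality of the cost for a single block update. -/
theorem bibpa_cyclic_cost_inequality_block
    {N : ℕ} {n : Fin N → ℕ}
    (h : (i : Fin N) → ((j : Fin N) → EuclideanSpace ℝ (Fin (n j))) → ℝ)
    (σ L : Fin N → ℝ) (hσ : ∀ i, 0 < σ i) (hL : ∀ i, 0 < L i)
    (hhdiff : ∀ i, Differentiable ℝ (h i))
    (hstrong : ∀ i x, ConvexOn ℝ Set.univ
      (fun z : EuclideanSpace ℝ (Fin (n i)) =>
        h i (Function.update x i z) - σ i / 2 * ‖z‖ ^ 2))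
    (f : ((j : Fin N) → EuclideanSpace ℝ (Fin (n j))) → ℝ)
    (hfdiff : Differentiable ℝ f)
    (hrel : ∀ i x, ConvexOn ℝ Set.univ
      (fun z : EuclideanSpace ℝ (Fin (n i)) =>
        L i * h i (Function.update x i z) - f (Function.update x i z)))
    (g : (i : Fin N) → EuclideanSpace ℝ (Fin (n i)) → EReal)
    (hgproper : ∀ i, ∃ z, g i z ≠ ⊤) (hgreal : ∀ i z, g i z ≠ ⊥)
    (hglsc : ∀ i, LowerSemicontinuous (g i))
    (x : ℕ → (j : Fin N) → EuclideanSpace ℝ (Fin (n j)))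
    (γ α : Fin N → ℕ → ℝ) (hγpos : ∀ i k, 0 < γ i k)
    (hfin : ∀ k i, g i (x k i) ≠ ⊤)
    (hmin : ∀ k, 1 ≤ k → ∀ (i : Fin N) (z : EuclideanSpace ℝ (Fin (n i))),
      g i (x (k + 1) i)
        + ((⟪blockGrad f i (interPt x k i)
              - (α i k / γ i k) • (x k i - x (k - 1) i), x (k + 1) i - x k i⟫
            + 1 / γ i k * blockBreg (h i) i (interPt x k i) (x (k + 1) i) : ℝ) : EReal)
      ≤ g i z
        + ((⟪blockGrad f i (interPt x k i)
              - (α i k / γ i k) • (x k i - x (k - 1) i), z - x k i⟫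
            + 1 / γ i k * blockBreg (h i) i (interPt x k i) z : ℝ) : EReal)) :
    ∀ k, 1 ≤ k → ∀ i : Fin N,
      Phi f g (interPt x k (i + 1)) ≤ Phi f g (interPt x k i)
        + (((|α i k| / (σ i * γ i k) - (1 - γ i k * L i) / γ i k)
              * bregTwo (h i) i (interPt x k (i + 1)) (interPt x k i)
            + |α i k| / (σ i * γ i k)
              * bregTwo (h i) i (interPt x (k - 1) (i + 1)) (interPt x (k - 1) i)
            : ℝ) : EReal) := by
  intro k hk i
  obtain ⟨k, rfl⟩ : ∃ m, k = m + 1 := ⟨k - 1, by omega⟩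
  have hinter : ∀ m j, g j (interPt x (k + 1) m j) ≠ ⊤ := fun m j => by
    unfold interPt
    split_ifs <;> exact hfin _ _
  rw [Phi_eq_coe f (hinter _) fun _ => hgreal _ _, Phi_eq_coe f (hinter _) fun _ => hgreal _ _,
    ← EReal.coe_add, EReal.coe_le_coe_iff]
  simp only [interPt_succ, bregTwo_update, Nat.add_sub_cancel]
  have hmin' := hmin (k + 1) hk i (x (k + 1) i)
  rw [← EReal.coe_toReal (hfin (k + 1 + 1) i) (hgreal i _),
    ← EReal.coe_toReal (hfin (k + 1) i) (hgreal i _), ← EReal.coe_add, ← EReal.coe_add,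
    EReal.coe_le_coe_iff, Nat.add_sub_cancel, sub_self, inner_zero_right, inner_sub_left]
    at hmin'
  have hsum := Finset.sum_apply_update_add (fun j z => (g j z).toReal)
    (interPt x (k + 1) i) i (x (k + 1 + 1) i)
  have hself := blockBreg_self (h i) i (interPt x (k + 1) i)
  have hdesc := blockBreg_le_mul_blockBreg (hrel i (interPt x (k + 1) i)) (hhdiff i) hfdiff
    (x (k + 1 + 1) i)
  have hnew := sq_norm_le_blockBreg (hstrong i (interPt x (k + 1) i)) (hhdiff i)
    (x (k + 1 + 1) i)
  have hold := sq_norm_le_blockBreg (hstrong i (interPt x k i)) (hhdiff i) (x (k + 1) i)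
  rw [blockBreg] at hdesc
  simp only [interPt_self] at hsum hself hdesc hnew hold
  rw [hself] at hmin'
  have hcross := inner_smul_le_abs_mul_sq_norm_add_sq_norm (α i (k + 1) / γ i (k + 1))
    (x (k + 1) i - x k i) (x (k + 1 + 1) i - x (k + 1) i)
  set D := blockBreg (h i) i (interPt x (k + 1) i) (x (k + 1 + 1) i)
  set D' := blockBreg (h i) i (interPt x k i) (x (k + 1) i)
  have hγ := hγpos i (k + 1)
  have hσi := hσ i
  have hyoung : |α i (k + 1) / γ i (k + 1)|
        * (‖x (k + 1) i - x k i‖ ^ 2 / 2 + ‖x (k + 1 + 1) i - x (k + 1) i‖ ^ 2 / 2)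
      ≤ |α i (k + 1)| / (σ i * γ i (k + 1)) * (D + D') := by
    rw [abs_div, abs_of_pos hγ]
    calc _ = |α i (k + 1)| / (σ i * γ i (k + 1)) * (σ i / 2 * ‖x (k + 1 + 1) i - x (k + 1) i‖ ^ 2
            + σ i / 2 * ‖x (k + 1) i - x k i‖ ^ 2) := by
          field_simp
          ring
      _ ≤ _ := by gcongr
  have hcoef : (1 - γ i (k + 1) * L i) / γ i (k + 1) = 1 / γ i (k + 1) - L i := by
    field_simp
  rw [hcoef]
  linarith
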